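/- Let Iₙ be the symmetric inverse monoid on n letters. Two idempotents 1_A and 1_B of Iₙ are D-related if and only if |A| = |B|, and the map sending the class [1_A] to |A| is an order isomorphism from Iₙ/J onto {0, 1, …, n} with its usual linear order; under this bijection the partial operation [e] ⊕ [f] becomes the partial addition r ⊕ s = r + s defined exactly when r + s ≤ n, complementation [e]' = [ē] becomes s' = n − s, and the total MV operation r ⊞ s = r ⊕ (r' ∧ s) becomes min(r + s, n). Hence Iₙ/J is isomorphic as an MV-algebra to the Łukasiewicz chain L_{n+1}. -/

import Mathlib

namespace Coordinatization

/-- The data of a monoid with zero equipped with an inverse operation. -/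
structure InvMonData (S : Type) where
  mul : S → S → S
  one : S
  zero : S
  inv : S → S

variable {S T : Type}

/-- `M` is an inverse monoid with zero: a monoid with zero in which every element `a`
has a unique generalized inverse `a⁻¹`. -/
structure IsInverseMonoid (M : InvMonData S) : Prop where
  mul_assoc : ∀ a b c, M.mul (M.mul a b) c = M.mul a (M.mul b c)
  one_mul : ∀ a, M.mul M.one a = a
  mul_one : ∀ a, M.mul a M.one = a
  zero_mul : ∀ a, M.mul M.zero a = M.zero
  mul_zero : ∀ a, M.mul a M.zero = M.zero
  inv_law₁ : ∀ a, M.mul (M.mul a (M.inv a)) a = a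
  inv_law₂ : ∀ a, M.mul (M.mul (M.inv a) a) (M.inv a) = M.inv a
  inv_unique : ∀ a b, M.mul (M.mul a b) a = a → M.mul (M.mul b a) b = b → b = M.inv a

/-- `e` is an idempotent. -/
def IsIdem (M : InvMonData S) (e : S) : Prop := M.mul e e = e

/-- The natural partial order: `a ≤ b` iff `a = b·e` for some idempotent `e`. -/
def nle (M : InvMonData S) (a b : S) : Prop := ∃ e, IsIdem M e ∧ a = M.mul b e

/-- `a` and `b` are compatible: `a⁻¹b` and `ab⁻¹` are both idempotents. -/
def Compatible (M : InvMonData S) (a b : S) : Prop :=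
  IsIdem M (M.mul (M.inv a) b) ∧ IsIdem M (M.mul a (M.inv b))

/-- `a` and `b` are orthogonal: `a⁻¹b = 0 = ab⁻¹`. -/
def Orthogonal (M : InvMonData S) (a b : S) : Prop :=
  M.mul (M.inv a) b = M.zero ∧ M.mul a (M.inv b) = M.zero

/-- `j` is the join of `a` and `b` with respect to the natural partial order. -/
def IsJoin (M : InvMonData S) (a b j : S) : Prop :=
  nle M a j ∧ nle M b j ∧ ∀ c, nle M a c → nle M b c → nle M j c

/-- `m` is the meet of `a` and `b` with respect to the natural partial order. -/
def IsMeet (M : InvMonData S) (a b m : S) : Prop :=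
  nle M m a ∧ nle M m b ∧ ∀ c, nle M c a → nle M c b → nle M c m

/-- Green's relation `D`: `e D f` iff there is `a` with `a⁻¹a = e` and `aa⁻¹ = f`. -/
def DRel (M : InvMonData S) (e f : S) : Prop :=
  ∃ a, M.mul (M.inv a) a = e ∧ M.mul a (M.inv a) = f

/-- `f` is a Boolean complement of the idempotent `e` in the Boolean algebra of
idempotents: `e·f = 0` and `e ∨ f = 1`. -/
def IsComplPair (M : InvMonData S) (e f : S) : Prop :=
  IsIdem M e ∧ IsIdem M f ∧ M.mul e f = M.zero ∧ IsJoin M e f M.one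

/-- A Boolean inverse monoid: an inverse monoid with zero in which the idempotents form a
Boolean algebra under the natural partial order (meets of idempotents are given by products;
complements exist), all compatible binary joins exist, and multiplication distributes over
binary joins. -/
structure IsBooleanInverseMonoid (M : InvMonData S) : Prop where
  invMon : IsInverseMonoid M
  joins_exist : ∀ a b, Compatible M a b → ∃ j, IsJoin M a b j
  mul_join_left : ∀ c a b j, IsJoin M a b j → IsJoin M (M.mul c a) (M.mul c b) (M.mul c j)
  mul_join_right : ∀ c a b j, IsJoin M a b j → IsJoin M (M.mul a c) (M.mul b c) (M.mul j c)
  compl_exists : ∀ e, IsIdem M e → ∃ f, IsComplPair M e f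

/-- The relation `D` preserves complementation: `e D f` implies `ē D f̄`. -/
def DPreservesCompl (M : InvMonData S) : Prop :=
  ∀ e f e' f', DRel M e f → IsComplPair M e e' → IsComplPair M f f' → DRel M e' f'

/-- `M` is completely semisimple: `e D f ≤ e` implies `e = f` for idempotents. -/
def CompletelySemisimple (M : InvMonData S) : Prop :=
  ∀ e f, IsIdem M e → IsIdem M f → DRel M e f → nle M f e → e = f

/-- A Foulis monoid: a completely semisimple Boolean inverse monoid in which `D`
preserves complementation. -/
def IsFoulis (M : InvMonData S) : Prop :=
  IsBooleanInverseMonoid M ∧ CompletelySemisimple M ∧ DPreservesCompl M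

/-- The preorder underlying `S/J`: `Jle s t` iff `SsS ⊆ StS`, i.e. `s = a·t·b` for some `a, b`. -/
def Jle (M : InvMonData S) (s t : S) : Prop := ∃ a b, s = M.mul (M.mul a t) b

/-- `S/J`, the poset of principal ideals, is a lattice. -/
def LatticeCondition (M : InvMonData S) : Prop :=
  ∀ s t : S,
    (∃ m, Jle M m s ∧ Jle M m t ∧ ∀ c, Jle M c s → Jle M c t → Jle M c m) ∧
    (∃ j, Jle M s j ∧ Jle M t j ∧ ∀ c, Jle M s c → Jle M t c → Jle M j c)

/-- `[e] ⊕ [f] = [g]` in `E(S)/D`: there are orthogonal idempotents `e' D e` and `f' D f`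
whose join is `D`-related to `g`. -/
def OplusEq (M : InvMonData S) (e f g : S) : Prop :=
  ∃ e' f' j, IsIdem M e' ∧ IsIdem M f' ∧ DRel M e e' ∧ DRel M f f' ∧
    M.mul e' f' = M.zero ∧ IsJoin M e' f' j ∧ DRel M j g

/-- `M` is fundamental: only idempotents commute with every idempotent. -/
def Fundamental (M : InvMonData S) : Prop :=
  ∀ s, (∀ e, IsIdem M e → M.mul s e = M.mul e s) → IsIdem M s

/-- `M` is factorizable: every element lies beneath a unit. -/
def Factorizable (M : InvMonData S) : Prop :=
  ∀ s, ∃ g, M.mul g (M.inv g) = M.one ∧ M.mul (M.inv g) g = M.one ∧ nle M s g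

/-- All binary meets exist (`∧`-monoid). -/
def HasMeets (M : InvMonData S) : Prop := ∀ a b, ∃ m, IsMeet M a b m

/-- A morphism of Boolean inverse `∧`-monoids: a monoid homomorphism mapping zero to zero,
preserving binary compatible joins and binary meets. -/
def IsMorphism (M : InvMonData S) (N : InvMonData T) (f : S → T) : Prop :=
  f M.one = N.one ∧ f M.zero = N.zero ∧
  (∀ a b, f (M.mul a b) = N.mul (f a) (f b)) ∧
  (∀ a b j, Compatible M a b → IsJoin M a b j → IsJoin N (f a) (f b) (f j)) ∧
  (∀ a b m, IsMeet M a b m → IsMeet N (f a) (f b) (f m))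

end Coordinatization
namespace Coordinatization

/-- The data of a partial algebra: a partially defined binary operation (encoded via
`Option`) together with constants `0` and `1`. -/
structure PartialAlg (E : Type) where
  add : E → E → Option E
  zero : E
  one : E

/-- The induced order: `a ≤ b` iff `b = a ⊕ c` for some `c`. -/
def PartialAlg.le {E : Type} (P : PartialAlg E) (a b : E) : Prop := ∃ c, P.add a c = some b

/-- An effect algebra: `⊕` is commutative and associative (as a partial operation),
`a ⊕ 1` is defined iff `a = 0`, and every element has a unique complement. -/
structure IsEffectAlgebra {E : Type} (P : PartialAlg E) : Prop where
  comm : ∀ a b, P.add a b = P.add b a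
  assoc : ∀ a b c, (P.add a b).bind (fun x => P.add x c) = (P.add b c).bind (fun y => P.add a y)
  one_def : ∀ a, (P.add a P.one).isSome ↔ a = P.zero
  compl : ∀ a, ∃! a', P.add a a' = some P.one

/-- The refinement property. -/
def HasRefinement {E : Type} (P : PartialAlg E) : Prop :=
  ∀ a₁ a₂ b₁ b₂ v, P.add a₁ a₂ = some v → P.add b₁ b₂ = some v →
    ∃ c₁₁ c₁₂ c₂₁ c₂₂, P.add c₁₁ c₁₂ = some a₁ ∧ P.add c₂₁ c₂₂ = some a₂ ∧
      P.add c₁₁ c₂₁ = some b₁ ∧ P.add c₁₂ c₂₂ = some b₂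

/-- The induced order is a lattice. -/
def LatticeOrdered {E : Type} (P : PartialAlg E) : Prop :=
  ∀ a b : E,
    (∃ m, P.le m a ∧ P.le m b ∧ ∀ c, P.le c a → P.le c b → P.le c m) ∧
    (∃ j, P.le a j ∧ P.le b j ∧ ∀ c, P.le a c → P.le b c → P.le j c)

/-- An MV-algebra: a lattice-ordered effect algebra with the refinement property. -/
def IsMV {E : Type} (P : PartialAlg E) : Prop :=
  IsEffectAlgebra P ∧ LatticeOrdered P ∧ HasRefinement P

/-- The MV-algebra `P` is co-ordinatized by the inverse monoid `M`: the map `φ` induces a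
bijection between `E(S)/D = S/J` and `E` carrying `[0]` to `0`, `[1]` to `1`, the partial
operation `⊕` on `D`-classes to the partial operation of `P`, and Boolean complementation
of `D`-classes to complementation in `P`; i.e. `S/J ≅ P` as MV-algebras. -/
def MVCoordinatizes {S E : Type} (M : InvMonData S) (P : PartialAlg E) : Prop :=
  ∃ φ : S → E,
    (∀ e f, IsIdem M e → IsIdem M f → (φ e = φ f ↔ DRel M e f)) ∧
    (∀ x : E, ∃ e, IsIdem M e ∧ φ e = x) ∧
    φ M.zero = P.zero ∧ φ M.one = P.one ∧
    (∀ e f z, IsIdem M e → IsIdem M f →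
      (P.add (φ e) (φ f) = some z ↔ ∃ g, IsIdem M g ∧ OplusEq M e f g ∧ φ g = z)) ∧
    (∀ e e', IsComplPair M e e' → P.add (φ e) (φ e') = some P.one)

end Coordinatization
namespace Coordinatization

/-- The symmetric inverse monoid `Iₙ` of all partial bijections of `Fin n`,
with composition as multiplication, the identity as `1`, the empty map as `0`,
and the inverse partial bijection as inversion. -/
def symData (n : ℕ) : InvMonData (PEquiv (Fin n) (Fin n)) where
  mul f g := g.trans f
  one := PEquiv.refl (Fin n)
  zero := ⊥
  inv f := f.symm

/-- Direct products of inverse monoids, with componentwise operations. -/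
def piData {ι : Type} {β : ι → Type} (Ms : ∀ i, InvMonData (β i)) :
    InvMonData (∀ i, β i) where
  mul f g i := (Ms i).mul (f i) (g i)
  one i := (Ms i).one
  zero i := (Ms i).zero
  inv f i := (Ms i).inv (f i)

/-- A semisimple inverse monoid: the finite direct product `I_{m 0} × ⋯ × I_{m (k-1)}`
of finite symmetric inverse monoids. -/
def ssData (k : ℕ) (m : Fin k → ℕ) :
    InvMonData (∀ i : Fin k, PEquiv (Fin (m i)) (Fin (m i))) :=
  piData (fun i => symData (m i))

/-- The partial identity `1_A` on a subset `A` of `Fin n`. -/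
def pid {n : ℕ} (A : Finset (Fin n)) : PEquiv (Fin n) (Fin n) where
  toFun x := if x ∈ A then some x else none
  invFun x := if x ∈ A then some x else none
  inv a b := by
    by_cases ha : a ∈ A <;> by_cases hb : b ∈ A <;>
      simp_all [Option.mem_def, eq_comm] <;> aesop

end Coordinatization
namespace Coordinatization

/-- The Łukasiewicz chain `L_{n+1}` on `{0, 1, …, n}`: `r ⊕ s = r + s` when
`r + s ≤ n` and undefined otherwise, with `0` and `n` as the constants. -/
def lukAlg (n : ℕ) : PartialAlg (Fin (n + 1)) where
  add r s := if h : (r : ℕ) + (s : ℕ) ≤ n then some ⟨(r : ℕ) + (s : ℕ), by omega⟩ else none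
  zero := ⟨0, by omega⟩
  one := ⟨n, by omega⟩

section SymmetricInverseMonoid

variable {n : ℕ}

theorem pequiv_ext_mem {α β : Type*} {f g : α ≃. β} (h : ∀ a b, b ∈ f a ↔ b ∈ g a) :
    f = g :=
  PEquiv.ext fun a => Option.ext fun b => h a b

theorem mem_pid {A : Finset (Fin n)} {a b : Fin n} : b ∈ pid A a ↔ a ∈ A ∧ a = b := by
  change b ∈ (if a ∈ A then some a else none) ↔ _
  by_cases h : a ∈ A <;> simp [h]

theorem mem_symData_mul {f g : PEquiv (Fin n) (Fin n)} {a c : Fin n} :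
    c ∈ (symData n).mul f g a ↔ ∃ b, b ∈ g a ∧ c ∈ f b :=
  PEquiv.mem_trans g f a c

theorem mem_symData_inv {f : PEquiv (Fin n) (Fin n)} {a b : Fin n} :
    a ∈ (symData n).inv f b ↔ b ∈ f a :=
  PEquiv.mem_iff_mem f

theorem mem_symData_inv_mul_self {f : PEquiv (Fin n) (Fin n)} {a c : Fin n} :
    c ∈ (symData n).mul ((symData n).inv f) f a ↔ a = c ∧ ∃ b, b ∈ f a := by
  simp only [mem_symData_mul, mem_symData_inv]
  constructor
  · rintro ⟨b, h, h'⟩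
    exact ⟨f.inj h h', b, h⟩
  · rintro ⟨rfl, b, h⟩
    exact ⟨b, h, h⟩

theorem mem_symData_mul_inv_self {f : PEquiv (Fin n) (Fin n)} {a c : Fin n} :
    c ∈ (symData n).mul f ((symData n).inv f) a ↔ a = c ∧ ∃ b, a ∈ f b := by
  simp only [mem_symData_mul, mem_symData_inv]
  constructor
  · rintro ⟨b, h, h'⟩
    exact ⟨Option.mem_unique h h', b, h⟩
  · rintro ⟨rfl, b, h⟩
    exact ⟨b, h, h⟩

theorem isIdem_pid (A : Finset (Fin n)) : IsIdem (symData n) (pid A) := by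
  refine pequiv_ext_mem fun a b => ?_
  simp only [mem_symData_mul, mem_pid]
  grind

/-- The domain of a partial bijection. -/
def pdom (f : PEquiv (Fin n) (Fin n)) : Finset (Fin n) :=
  Finset.univ.filter fun x => (f x).isSome

theorem mem_pdom {f : PEquiv (Fin n) (Fin n)} {a : Fin n} : a ∈ pdom f ↔ ∃ b, b ∈ f a := by
  simp [pdom, Option.isSome_iff_exists]

theorem pdom_pid (A : Finset (Fin n)) : pdom (pid A) = A := by
  ext a
  simp only [mem_pdom, mem_pid, exists_and_left, exists_eq', and_true]

theorem eq_pid_of_isIdem {e : PEquiv (Fin n) (Fin n)} (he : IsIdem (symData n) e) :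
    e = pid (pdom e) := by
  have key : ∀ a b, b ∈ e a → a = b := by
    intro a b hab
    have h := hab
    rw [← he, mem_symData_mul] at h
    obtain ⟨c, hac, hcb⟩ := h
    have hbc : b = c := Option.mem_unique hab hac
    exact e.inj hab (hbc ▸ hcb)
  refine pequiv_ext_mem fun a b => ?_
  rw [mem_pid, mem_pdom]
  constructor
  · exact fun h => ⟨⟨b, h⟩, key a b h⟩
  · rintro ⟨⟨c, hc⟩, rfl⟩
    exact (key a c hc).symm ▸ hc

theorem symData_zero_eq_pid : (symData n).zero = pid ∅ := by
  refine pequiv_ext_mem fun a b => ?_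
  rw [mem_pid]
  simp [symData]

theorem symData_one_eq_pid : (symData n).one = pid Finset.univ := by
  refine pequiv_ext_mem fun a b => ?_
  rw [mem_pid]
  simp [symData]

theorem pid_injective : Function.Injective (pid (n := n)) :=
  Function.LeftInverse.injective pdom_pid

theorem pid_mul_pid (A B : Finset (Fin n)) :
    (symData n).mul (pid A) (pid B) = pid (A ∩ B) := by
  refine pequiv_ext_mem fun a b => ?_
  simp only [mem_symData_mul, mem_pid, Finset.mem_inter]
  grind

theorem nle_symData_iff {f g : PEquiv (Fin n) (Fin n)} : nle (symData n) f g ↔ f ≤ g := by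
  constructor
  · rintro ⟨e, he, rfl⟩ a b h
    rw [eq_pid_of_isIdem he] at h
    obtain ⟨c, hc, hb⟩ := mem_symData_mul.1 h
    obtain ⟨-, rfl⟩ := mem_pid.1 hc
    exact hb
  · intro h
    refine ⟨pid (pdom f), isIdem_pid _, pequiv_ext_mem fun a b => ?_⟩
    simp only [mem_symData_mul, mem_pid, mem_pdom]
    constructor
    · exact fun hab => ⟨a, ⟨⟨b, hab⟩, rfl⟩, h a b hab⟩
    · rintro ⟨c, ⟨⟨d, hd⟩, rfl⟩, hb⟩
      exact Option.mem_unique (h a d hd) hb ▸ hd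

theorem pid_le_iff {A : Finset (Fin n)} {f : PEquiv (Fin n) (Fin n)} :
    pid A ≤ f ↔ ∀ a ∈ A, a ∈ f a := by
  constructor
  · exact fun h a ha => h a a (mem_pid.2 ⟨ha, rfl⟩)
  · intro h a b hab
    obtain ⟨ha, rfl⟩ := mem_pid.1 hab
    exact h a ha

theorem isJoin_pid (A B : Finset (Fin n)) :
    IsJoin (symData n) (pid A) (pid B) (pid (A ∪ B)) := by
  simp only [IsJoin, nle_symData_iff, pid_le_iff, mem_pid, Finset.mem_union]
  grind

theorem isJoin_symData_unique {f g j k : PEquiv (Fin n) (Fin n)}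
    (hj : IsJoin (symData n) f g j) (hk : IsJoin (symData n) f g k) : j = k :=
  le_antisymm (nle_symData_iff.1 (hj.2.2 k hk.1 hk.2.1))
    (nle_symData_iff.1 (hk.2.2 j hj.1 hj.2.1))

theorem exists_perm_mem_iff_of_card_eq {α : Type*} [Fintype α] [DecidableEq α] {A B : Finset α}
    (h : A.card = B.card) : ∃ σ : Equiv.Perm α, ∀ x, σ x ∈ B ↔ x ∈ A := by
  let e : {x // x ∈ A} ≃ {x // x ∈ B} := Finset.equivOfCardEq h
  refine ⟨e.extendSubtype, fun x => ⟨fun hx => ?_, e.extendSubtype_mem x⟩⟩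
  by_contra hA
  exact e.extendSubtype_not_mem x hA hx

theorem card_le_of_pequiv {A B : Finset (Fin n)} (f : PEquiv (Fin n) (Fin n))
    (h : ∀ a ∈ A, ∃ b ∈ B, b ∈ f a) : A.card ≤ B.card := by
  choose! g hgB hg using h
  exact Finset.card_le_card_of_injOn g hgB fun a ha b hb hab =>
    f.inj (hg a ha) (hab ▸ hg b hb)

theorem dRel_pid_iff {A B : Finset (Fin n)} :
    DRel (symData n) (pid A) (pid B) ↔ A.card = B.card := by
  constructor
  · rintro ⟨f, hA, hB⟩
    have hA' : ∀ a, a ∈ A ↔ ∃ b, b ∈ f a := fun a => by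
      have := mem_symData_inv_mul_self (f := f) (a := a) (c := a)
      rw [hA, mem_pid] at this
      simpa using this
    have hB' : ∀ b, b ∈ B ↔ ∃ a, b ∈ f a := fun b => by
      have := mem_symData_mul_inv_self (f := f) (a := b) (c := b)
      rw [hB, mem_pid] at this
      simpa using this
    apply le_antisymm
    · refine card_le_of_pequiv f fun a ha => ?_
      obtain ⟨b, hb⟩ := (hA' a).1 ha
      exact ⟨b, (hB' b).2 ⟨a, hb⟩, hb⟩
    · refine card_le_of_pequiv f.symm fun b hb => ?_
      obtain ⟨a, ha⟩ := (hB' b).1 hb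
      exact ⟨a, (hA' a).2 ⟨b, ha⟩, (PEquiv.mem_iff_mem f).2 ha⟩
  · intro h
    obtain ⟨σ, hσ⟩ := exists_perm_mem_iff_of_card_eq h
    have mem_f : ∀ a b, b ∈ (pid A).trans σ.toPEquiv a ↔ a ∈ A ∧ σ a = b := fun a b => by
      simp only [PEquiv.mem_trans, mem_pid, Equiv.toPEquiv_apply, Option.mem_some_iff]
      grind
    refine ⟨(pid A).trans σ.toPEquiv, pequiv_ext_mem fun a b => ?_, pequiv_ext_mem fun a b => ?_⟩
    · rw [mem_symData_inv_mul_self, mem_pid]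
      simp only [mem_f]
      grind
    · rw [mem_symData_mul_inv_self, mem_pid]
      simp only [mem_f]
      constructor
      · rintro ⟨rfl, c, hc, rfl⟩
        exact ⟨(hσ c).2 hc, rfl⟩
      · rintro ⟨ha, rfl⟩
        refine ⟨rfl, σ.symm a, (hσ _).1 ?_, σ.apply_symm_apply a⟩
        rwa [σ.apply_symm_apply]

theorem jle_pid_iff {A B : Finset (Fin n)} :
    Jle (symData n) (pid A) (pid B) ↔ A.card ≤ B.card := by
  constructor
  · rintro ⟨f, g, h⟩
    refine card_le_of_pequiv g fun a ha => ?_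
    have hm : a ∈ pid A a := mem_pid.2 ⟨ha, rfl⟩
    rw [h] at hm
    obtain ⟨b, hb, hm⟩ := mem_symData_mul.1 hm
    obtain ⟨c, hc, -⟩ := mem_symData_mul.1 hm
    exact ⟨b, (mem_pid.1 hc).1, hb⟩
  · intro h
    obtain ⟨B', hB', hcard⟩ := Finset.exists_subset_card_eq h
    obtain ⟨f, hA, hB⟩ := dRel_pid_iff.2 hcard.symm
    refine ⟨(symData n).inv f, f, ?_⟩
    rw [← hA]
    refine pequiv_ext_mem fun a b => ?_
    simp only [mem_symData_mul, mem_symData_inv, mem_pid]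
    constructor
    · rintro ⟨c, hac, hbc⟩
      have hc : c ∈ pid B' c := by
        rw [← hB, mem_symData_mul_inv_self]
        exact ⟨rfl, a, hac⟩
      exact ⟨c, hac, c, ⟨hB' (mem_pid.1 hc).1, rfl⟩, hbc⟩
    · rintro ⟨c, hac, d, ⟨-, rfl⟩, hbd⟩
      exact ⟨c, hac, hbd⟩

theorem oplusEq_pid_iff {A B C : Finset (Fin n)} :
    OplusEq (symData n) (pid A) (pid B) (pid C) ↔
      A.card + B.card ≤ n ∧ C.card = A.card + B.card := by
  constructor
  · rintro ⟨e, f, j, he, hf, hAe, hBf, hef, hj, hjC⟩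
    rw [eq_pid_of_isIdem he] at hAe hef hj
    rw [eq_pid_of_isIdem hf] at hBf hef hj
    rw [isJoin_symData_unique hj (isJoin_pid _ _), dRel_pid_iff] at hjC
    rw [pid_mul_pid, symData_zero_eq_pid] at hef
    rw [dRel_pid_iff] at hAe hBf
    rw [Finset.card_union_of_disjoint
      (Finset.disjoint_iff_inter_eq_empty.2 (pid_injective hef))] at hjC
    have := card_finset_fin_le C
    omega
  · rintro ⟨hle, hC⟩
    have hB : B.card ≤ Aᶜ.card := by
      rw [Finset.card_compl, Fintype.card_fin]
      omega
    obtain ⟨B', hB', hcard⟩ := Finset.exists_subset_card_eq hB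
    have hdisj : Disjoint A B' := Finset.subset_compl_iff_disjoint_left.1 hB'
    refine ⟨pid A, pid B', pid (A ∪ B'), isIdem_pid _, isIdem_pid _, dRel_pid_iff.2 rfl,
      dRel_pid_iff.2 hcard.symm, ?_, isJoin_pid _ _, dRel_pid_iff.2 ?_⟩
    · rw [pid_mul_pid, symData_zero_eq_pid, Finset.disjoint_iff_inter_eq_empty.1 hdisj]
    · rw [Finset.card_union_of_disjoint hdisj, hcard, hC]

theorem isComplPair_pid_iff {A B : Finset (Fin n)} :
    IsComplPair (symData n) (pid A) (pid B) ↔ A ∩ B = ∅ ∧ A ∪ B = Finset.univ := by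
  constructor
  · rintro ⟨-, -, h0, h1⟩
    rw [pid_mul_pid, symData_zero_eq_pid] at h0
    rw [symData_one_eq_pid] at h1
    exact ⟨pid_injective h0, pid_injective (isJoin_symData_unique (isJoin_pid A B) h1)⟩
  · rintro ⟨h0, h1⟩
    refine ⟨isIdem_pid _, isIdem_pid _, ?_, ?_⟩
    · rw [pid_mul_pid, symData_zero_eq_pid, h0]
    · rw [symData_one_eq_pid, ← h1]
      exact isJoin_pid A B

theorem exists_finset_card_eq_of_le {k : ℕ} (hk : k ≤ n) :
    ∃ A : Finset (Fin n), A.card = k := by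
  obtain ⟨A, -, hA⟩ := Finset.exists_subset_card_eq (s := (Finset.univ : Finset (Fin n)))
    (n := k) (by simpa using hk)
  exact ⟨A, hA⟩

end SymmetricInverseMonoid

section LukasiewiczChain

variable {n : ℕ}

theorem lukAlg_add_eq_some_iff {r s t : Fin (n + 1)} :
    (lukAlg n).add r s = some t ↔ (r : ℕ) + s = t := by
  have ht := t.isLt
  by_cases h : (r : ℕ) + s ≤ n
  · simp [lukAlg, h, Fin.ext_iff]
  · simp only [lukAlg, h, dite_false, reduceCtorEq, false_iff]
    omega

theorem lukAlg_le_iff {r s : Fin (n + 1)} : (lukAlg n).le r s ↔ r ≤ s := by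
  simp only [PartialAlg.le, lukAlg_add_eq_some_iff, Fin.le_def]
  constructor
  · rintro ⟨c, hc⟩
    omega
  · intro h
    exact ⟨⟨s - r, by omega⟩, Nat.add_sub_cancel' h⟩

theorem isEffectAlgebra_lukAlg (n : ℕ) : IsEffectAlgebra (lukAlg n) where
  comm a b := by
    ext c
    rw [lukAlg_add_eq_some_iff, lukAlg_add_eq_some_iff, add_comm]
  assoc a b c := by
    ext d
    simp only [Option.bind_eq_some_iff, lukAlg_add_eq_some_iff]
    constructor
    · rintro ⟨x, hx, hd⟩
      exact ⟨⟨b + c, by omega⟩, rfl, by simp only; omega⟩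
    · rintro ⟨x, hx, hd⟩
      exact ⟨⟨a + b, by omega⟩, rfl, by simp only; omega⟩
  one_def a := by
    simp only [Option.isSome_iff_exists, lukAlg_add_eq_some_iff, Fin.ext_iff]
    simp only [lukAlg]
    constructor
    · rintro ⟨x, hx⟩
      omega
    · intro h
      exact ⟨⟨n, by omega⟩, by simp only; omega⟩
  compl a := by
    simp only [lukAlg_add_eq_some_iff]
    simp only [lukAlg]
    refine ⟨⟨n - a, by omega⟩, by simp only; omega, fun b hb => ?_⟩
    rw [Fin.ext_iff]
    simp only
    omega

theorem latticeOrdered_lukAlg (n : ℕ) : LatticeOrdered (lukAlg n) := by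
  intro a b
  simp only [lukAlg_le_iff]
  exact ⟨⟨a ⊓ b, inf_le_left, inf_le_right, fun _ => le_inf⟩,
    ⟨a ⊔ b, le_sup_left, le_sup_right, fun _ => sup_le⟩⟩

theorem hasRefinement_lukAlg (n : ℕ) : HasRefinement (lukAlg n) := by
  intro a₁ a₂ b₁ b₂ v ha hb
  simp only [lukAlg_add_eq_some_iff] at ha hb ⊢
  obtain ⟨m, hm⟩ : ∃ m : ℕ, m = min (a₁ : ℕ) b₁ := ⟨_, rfl⟩
  refine ⟨⟨m, by omega⟩, ⟨(a₁ : ℕ) - m, by omega⟩, ⟨(b₁ : ℕ) - m, by omega⟩,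
    ⟨(a₂ : ℕ) - (b₁ - m), by omega⟩, ?_, ?_, ?_, ?_⟩ <;> simp only <;> omega

theorem isMV_lukAlg (n : ℕ) : IsMV (lukAlg n) :=
  ⟨isEffectAlgebra_lukAlg n, latticeOrdered_lukAlg n, hasRefinement_lukAlg n⟩

end LukasiewiczChain

/-- In the symmetric inverse monoid `Iₙ`: every idempotent is a partial identity `1_A`;
idempotents `1_A` and `1_B` are `D`-related iff `|A| = |B|`; the map `[1_A] ↦ |A|` is an
order isomorphism from `Iₙ/J` onto `{0, 1, …, n}` with the usual order; under it, `⊕`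
becomes the partial addition `r ⊕ s = r + s` defined exactly when `r + s ≤ n`;
complementation becomes `s' = n - s`; the total operation `r ⊞ s = r ⊕ (r' ∧ s)` becomes
`min (r + s) n`; and hence `Iₙ/J` is isomorphic as an MV-algebra to the Łukasiewicz chain
`L_{n+1}`. -/
theorem symmetric_inverse_monoid_lukasiewicz (n : ℕ) :
    (∀ e, IsIdem (symData n) e → ∃ A : Finset (Fin n), e = pid A) ∧
    (∀ A B : Finset (Fin n),
      DRel (symData n) (pid A) (pid B) ↔ A.card = B.card) ∧
    (∀ A B : Finset (Fin n),
      Jle (symData n) (pid A) (pid B) ↔ A.card ≤ B.card) ∧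
    (∀ k : ℕ, k ≤ n → ∃ A : Finset (Fin n), A.card = k) ∧
    (∀ A B C : Finset (Fin n),
      OplusEq (symData n) (pid A) (pid B) (pid C) ↔
        A.card + B.card ≤ n ∧ C.card = A.card + B.card) ∧
    (∀ A : Finset (Fin n),
      IsComplPair (symData n) (pid A) (pid Aᶜ) ∧ Aᶜ.card = n - A.card) ∧
    (∀ r s : ℕ, r ≤ n → s ≤ n → r + min (n - r) s = min (r + s) n) ∧
    IsMV (lukAlg n) ∧
    (∃ φ : PEquiv (Fin n) (Fin n) → Fin (n + 1),
      (∀ A : Finset (Fin n), (φ (pid A) : ℕ) = A.card) ∧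
      (∀ e f, IsIdem (symData n) e → IsIdem (symData n) f →
        (φ e = φ f ↔ DRel (symData n) e f)) ∧
      (∀ x : Fin (n + 1), ∃ e, IsIdem (symData n) e ∧ φ e = x) ∧
      φ (symData n).zero = (lukAlg n).zero ∧ φ (symData n).one = (lukAlg n).one ∧
      (∀ e f z, IsIdem (symData n) e → IsIdem (symData n) f →
        ((lukAlg n).add (φ e) (φ f) = some z ↔
          ∃ g, IsIdem (symData n) g ∧ OplusEq (symData n) e f g ∧ φ g = z)) ∧
      (∀ e e', IsComplPair (symData n) e e' →
        (lukAlg n).add (φ e) (φ e') = some (lukAlg n).one)) := by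
 
  let φ : PEquiv (Fin n) (Fin n) → Fin (n + 1) := fun f =>
    ⟨(pdom f).card, Nat.lt_succ_of_le (card_finset_fin_le _)⟩
  have hφ : ∀ A, (φ (pid A) : ℕ) = A.card := fun A => congrArg Finset.card (pdom_pid A)
  refine ⟨fun e he => ⟨_, eq_pid_of_isIdem he⟩, fun A B => dRel_pid_iff, fun A B => jle_pid_iff,
    fun k hk => exists_finset_card_eq_of_le hk, fun A B C => oplusEq_pid_iff, fun A => ⟨?_, ?_⟩,
    fun r s hr hs => by omega, isMV_lukAlg n, φ, hφ, fun e f he hf => ?_, fun x => ?_, ?_, ?_,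
    fun e f z he hf => ?_, fun e e' h => ?_⟩
  · exact isComplPair_pid_iff.2 ⟨Finset.inter_compl A, Finset.union_compl A⟩
  · rw [Finset.card_compl, Fintype.card_fin]
  · rw [eq_pid_of_isIdem he, eq_pid_of_isIdem hf, dRel_pid_iff, Fin.ext_iff, hφ, hφ]
  · obtain ⟨A, hA⟩ := exists_finset_card_eq_of_le (Nat.le_of_lt_succ x.isLt)
    exact ⟨pid A, isIdem_pid A, Fin.ext ((hφ A).trans hA)⟩
  · rw [symData_zero_eq_pid]
    exact Fin.ext ((hφ _).trans Finset.card_empty)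
  · rw [symData_one_eq_pid]
    exact Fin.ext ((hφ _).trans (Finset.card_fin n))
  · rw [eq_pid_of_isIdem he, eq_pid_of_isIdem hf, lukAlg_add_eq_some_iff, hφ, hφ]
    constructor
    · intro h
      have hz := Nat.le_of_lt_succ z.isLt
      obtain ⟨C, hC⟩ := exists_finset_card_eq_of_le hz
      exact ⟨pid C, isIdem_pid C, oplusEq_pid_iff.2 ⟨h ▸ hz, hC.trans h.symm⟩,
        Fin.ext ((hφ C).trans hC)⟩
    · rintro ⟨g, hg, hsum, rfl⟩
      rw [eq_pid_of_isIdem hg] at hsum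
      exact (oplusEq_pid_iff.1 hsum).2.symm
  · rw [eq_pid_of_isIdem h.1, eq_pid_of_isIdem h.2.1, isComplPair_pid_iff] at h
    rw [lukAlg_add_eq_some_iff]
    change (pdom e).card + (pdom e').card = n
    rw [← Finset.card_union_of_disjoint (Finset.disjoint_iff_inter_eq_empty.2 h.1), h.2,
      Finset.card_fin]

end Coordinatization
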